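/- Let λ ∈ V be a dominant weight and let w ∈ W be the maximal-length element of its coset wW_λ, where W_λ := {σ ∈ W : σλ = λ}. Fix an index 1 ≤ i ≤ r and v ∈ W^{P_i}, and let u ∈ W^{P_i} be the minimal-length representative of (w⁻¹ * v) W_{P_i}. Then {xλ : x ∈ W, x ≤ w, ⟨xλ, v x_i⟩ = ⟨λ, u x_i⟩} = {xλ : x ∈ v W_{P_i} u⁻¹, x ≤ w}; that is, the vertices of P_λ^w lying on the face {μ ∈ P_λ^w : ⟨μ, v x_i⟩ = ⟨λ, u x_i⟩} are exactly the points xλ with x ∈ v W_{P_i} u⁻¹ and x ≤ w. -/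

import Mathlib

open scoped Classical

/-- Data of a root system with a fixed choice of simple roots: an ambient
`ℚ`-vector space `V`, a set of roots `Φ` with a distinguished subset `pos` of
positive roots, a coroot functional `coroot β = ⟨·, β^∨⟩` for each root, and
simple roots `α 1, …, α r`. -/
structure RootData where
  r : ℕ
  V : Type
  [grp : AddCommGroup V]
  [mod : Module ℚ V]
  Φ : Set V
  pos : Set V
  coroot : V → Module.Dual ℚ V
  α : Fin r → V

attribute [instance] RootData.grp RootData.mod

namespace RootData

variable (R : RootData)

/-- The group of linear automorphisms of `V`, in which the Weyl group lives. -/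
abbrev Aut : Type := R.V ≃ₗ[ℚ] R.V

/-- The linear map `v ↦ v - ⟨v, β^∨⟩ β`. -/
noncomputable def reflMap (β : R.V) : R.V →ₗ[ℚ] R.V :=
  LinearMap.id - (R.coroot β).smulRight β

/-- The reflection `s_β` associated to a root `β`, as a linear automorphism. -/
noncomputable def s (β : R.V) : R.Aut :=
  if h : (R.reflMap β).comp (R.reflMap β) = LinearMap.id then
    LinearEquiv.ofLinear (R.reflMap β) (R.reflMap β) h h
  else LinearEquiv.refl ℚ R.V

/-- The simple reflections `s_i := s_{α_i}`. -/
noncomputable def S (i : Fin R.r) : R.Aut := R.s (R.α i)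

/-- The Weyl group `W`, generated by the simple reflections. -/
noncomputable def weylGroup : Subgroup R.Aut := Subgroup.closure (Set.range R.S)

/-- The product `s_{i_1} ⋯ s_{i_k}` of a word in the simple reflections. -/
noncomputable def wordProd (l : List (Fin R.r)) : R.Aut := (l.map R.S).prod

/-- The length function on `W`: least length of a word in the simple
reflections expressing the given element. -/
noncomputable def len (w : R.Aut) : ℕ :=
  sInf {n | ∃ l : List (Fin R.r), l.length = n ∧ R.wordProd l = w}

/-- A word is reduced if its length equals the length of its product. -/
def Reduced (l : List (Fin R.r)) : Prop := R.len (R.wordProd l) = l.length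

/-- The Bruhat order on `W`: `u ≤ w` iff some reduced word for `w` has a
subword whose product is `u`. -/
def BruhatLE (u w : R.Aut) : Prop :=
  ∃ l : List (Fin R.r), R.Reduced l ∧ R.wordProd l = w ∧
    ∃ l' : List (Fin R.r), l'.Sublist l ∧ R.wordProd l' = u

/-- Strict Bruhat order. -/
def BruhatLT (u w : R.Aut) : Prop := R.BruhatLE u w ∧ u ≠ w

/-- One step of the Demazure product: `s_i * w := max {w, s_i w}`. -/
noncomputable def dmulStep (i : Fin R.r) (x : R.Aut) : R.Aut :=
  if R.len x < R.len (R.S i * x) then R.S i * x else x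

/-- Demazure product of a word in the simple reflections against `w`:
`s_{i_1} * (s_{i_2} * (⋯ * (s_{i_k} * w)))`. -/
noncomputable def dmulList (l : List (Fin R.r)) (w : R.Aut) : R.Aut :=
  l.foldr R.dmulStep w

/-- The Demazure product `v * w` on the Weyl group, computed by choosing a
reduced word for `v` (it is independent of this choice). -/
noncomputable def dmul (v w : R.Aut) : R.Aut :=
  if h : ∃ l : List (Fin R.r), R.Reduced l ∧ R.wordProd l = v then
    R.dmulList h.choose w
  else v * w

/-- The parabolic subgroup `W_{P_i}` generated by the simple reflections
`s_j`, `j ≠ i`. -/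
noncomputable def WPar (i : Fin R.r) : Subgroup R.Aut :=
  Subgroup.closure (R.S '' {j | j ≠ i})

/-- `W^{P_i}`: the set of minimal-length representatives of cosets of
`W/W_{P_i}`. -/
def minReps (i : Fin R.r) : Set R.Aut :=
  {v | v ∈ R.weylGroup ∧ ∀ p ∈ R.WPar i, R.len v ≤ R.len (v * p)}

/-- `u` is the minimal-length representative of the coset `w W_{P_i}`. -/
def IsMinRep (i : Fin R.r) (u w : R.Aut) : Prop :=
  u ∈ R.minReps i ∧ u⁻¹ * w ∈ R.WPar i

/-- A weight is dominant if it pairs nonnegatively with every simple coroot. -/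
def Dominant (lam : R.V) : Prop := ∀ i : Fin R.r, 0 ≤ R.coroot (R.α i) lam

/-- The dual action of the Weyl group on `V* `: `(u f)(v) = f(u⁻¹ v)`. -/
noncomputable def dualAct (u : R.Aut) (f : Module.Dual ℚ R.V) : Module.Dual ℚ R.V :=
  f.comp (u.symm : R.V →ₗ[ℚ] R.V)

/-- The Demazure polytope `P_λ^w := conv {uλ : u ∈ W, u ≤ w}`. -/
noncomputable def demPolytope (lam : R.V) (w : R.Aut) : Set R.V :=
  convexHull ℚ {m | ∃ u : R.Aut, u ∈ R.weylGroup ∧ R.BruhatLE u w ∧ m = u lam}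

/-- Membership in the weight lattice `X`. -/
def IsWeight (lam : R.V) : Prop := ∀ β ∈ R.Φ, ∃ m : ℤ, R.coroot β lam = (m : ℚ)

/-- The root lattice `Q = ℤΦ`. -/
noncomputable def rootLattice : AddSubgroup R.V := AddSubgroup.closure R.Φ

/-- `w₀` is the longest element of the Weyl group. -/
def IsLongest (w₀ : R.Aut) : Prop :=
  w₀ ∈ R.weylGroup ∧ ∀ g ∈ R.weylGroup, R.len g ≤ R.len w₀

/-- The positive roots `Φ_{P_i}⁺ = Φ⁺ ∩ span {α_j : j ≠ i}` of the standard
Levi subsystem. -/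
def parPos (i : Fin R.r) : Set R.V :=
  {η | η ∈ R.pos ∧ η ∈ Submodule.span ℚ (R.α '' {j | j ≠ i})}

/-- The value `D_i (e^λ)` of the Demazure operator on a basis element of the
group ring `ℤ[X]`. -/
noncomputable def demOnBasis (i : Fin R.r) (lam : R.V) : R.V →₀ ℤ :=
  if 0 ≤ ⌊R.coroot (R.α i) lam⌋ then
    ∑ k ∈ Finset.range (⌊R.coroot (R.α i) lam⌋.toNat + 1),
      Finsupp.single (lam - (k : ℚ) • R.α i) 1
  else if ⌊R.coroot (R.α i) lam⌋ = -1 then 0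
  else - ∑ k ∈ Finset.range ((-⌊R.coroot (R.α i) lam⌋).toNat - 1),
      Finsupp.single (lam + ((k : ℚ) + 1) • R.α i) 1

/-- The Demazure operator `D_i`, as a `ℤ`-linear endomorphism of the group
ring `ℤ[X]` (realized as finitely supported functions `V →₀ ℤ`). -/
noncomputable def demOp (i : Fin R.r) : (R.V →₀ ℤ) →ₗ[ℤ] (R.V →₀ ℤ) :=
  Finsupp.lsum ℤ fun lam => LinearMap.toSpanSingleton ℤ (R.V →₀ ℤ) (R.demOnBasis i lam)

/-- The Demazure character `D_{i_1} ⋯ D_{i_k} (e^λ)`. -/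
noncomputable def demChar (l : List (Fin R.r)) (lam : R.V) : R.V →₀ ℤ :=
  l.foldr (fun i p => R.demOp i p) (Finsupp.single lam 1)

/-- The axioms of a finite crystallographic root system spanning `V`, with
simple roots `α_i` and positive roots `pos`. -/
structure IsRootSystem (R : RootData) : Prop where
  finite : R.Φ.Finite
  span_top : Submodule.span ℚ R.Φ = ⊤
  ne_zero : ∀ β ∈ R.Φ, β ≠ 0
  coroot_self : ∀ β ∈ R.Φ, R.coroot β β = 2
  crystallographic : ∀ β ∈ R.Φ, ∀ γ ∈ R.Φ, ∃ m : ℤ, R.coroot β γ = (m : ℚ)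
  reflection_stable : ∀ β ∈ R.Φ, ∀ γ ∈ R.Φ, γ - R.coroot β γ • β ∈ R.Φ
  simple_mem : ∀ i, R.α i ∈ R.Φ
  indep : LinearIndependent ℚ R.α
  pos_subset : R.pos ⊆ R.Φ
  pos_or_neg : ∀ β ∈ R.Φ, (β ∈ R.pos ∧ -β ∉ R.pos) ∨ (β ∉ R.pos ∧ -β ∈ R.pos)
  simple_pos : ∀ i, R.α i ∈ R.pos
  pos_nonneg_comb : ∀ β ∈ R.pos, ∃ c : Fin R.r → ℚ, (∀ i, 0 ≤ c i) ∧ β = ∑ i, c i • R.α i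

end RootData

namespace RootData

variable {R : RootData}

namespace IsRootSystem

lemma s_apply (hR : R.IsRootSystem) {β : R.V} (hβ : β ∈ R.Φ) (y : R.V) :
    R.s β y = y - R.coroot β y • β := by
  have h : (R.reflMap β).comp (R.reflMap β) = LinearMap.id := by
    ext z
    have h2 := hR.coroot_self β hβ
    simp only [reflMap, LinearMap.comp_apply, LinearMap.sub_apply, LinearMap.id_apply,
      LinearMap.smulRight_apply, map_sub, map_smul, h2]
    module
  rw [s, dif_pos h]
  rfl

lemma s_mul_self (hR : R.IsRootSystem) {β : R.V} (hβ : β ∈ R.Φ) : R.s β * R.s β = 1 := by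
  ext y
  have h2 := hR.coroot_self β hβ
  simp only [LinearEquiv.mul_apply, hR.s_apply hβ, map_sub, map_smul, h2, smul_eq_mul,
    LinearEquiv.coe_one, id_eq]
  module

lemma s_s_apply (hR : R.IsRootSystem) {β : R.V} (hβ : β ∈ R.Φ) (y : R.V) :
    R.s β (R.s β y) = y := by
  rw [← LinearEquiv.mul_apply, hR.s_mul_self hβ, LinearEquiv.coe_one, id_eq]

lemma s_mem (hR : R.IsRootSystem) {β γ : R.V} (hβ : β ∈ R.Φ) (hγ : γ ∈ R.Φ) :
    R.s β γ ∈ R.Φ := by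
  rw [hR.s_apply hβ]
  exact hR.reflection_stable β hβ γ hγ

lemma S_mul_self (hR : R.IsRootSystem) (j : Fin R.r) : R.S j * R.S j = 1 :=
  hR.s_mul_self (hR.simple_mem j)

lemma S_inv (hR : R.IsRootSystem) (j : Fin R.r) : (R.S j)⁻¹ = R.S j :=
  inv_eq_of_mul_eq_one_right (hR.S_mul_self j)

lemma s_inv (hR : R.IsRootSystem) {β : R.V} (hβ : β ∈ R.Φ) : (R.s β)⁻¹ = R.s β :=
  inv_eq_of_mul_eq_one_right (hR.s_mul_self hβ)

lemma s_self (hR : R.IsRootSystem) {β : R.V} (hβ : β ∈ R.Φ) : R.s β β = -β := by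
  rw [hR.s_apply hβ, hR.coroot_self β hβ]
  module

lemma S_simple (hR : R.IsRootSystem) (j : Fin R.r) : R.S j (R.α j) = -R.α j :=
  hR.s_self (hR.simple_mem j)

lemma neg_mem (hR : R.IsRootSystem) {β : R.V} (hβ : β ∈ R.Φ) : -β ∈ R.Φ := by
  rw [← hR.s_self hβ, hR.s_apply hβ]
  exact hR.reflection_stable β hβ β hβ

lemma neg_mem_pos (hR : R.IsRootSystem) {β : R.V} (hβ : β ∈ R.Φ) (h : β ∉ R.pos) :
    -β ∈ R.pos := by
  rcases hR.pos_or_neg β hβ with h' | h'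
  · exact absurd h'.1 h
  · exact h'.2

lemma neg_notMem_pos (hR : R.IsRootSystem) {β : R.V} (h : β ∈ R.pos) : -β ∉ R.pos := by
  rcases hR.pos_or_neg β (hR.pos_subset h) with h' | h'
  · exact h'.2
  · exact absurd h h'.1

lemma S_mem_weylGroup (j : Fin R.r) : R.S j ∈ R.weylGroup :=
  Subgroup.subset_closure ⟨j, rfl⟩

lemma weylGroup_stable (hR : R.IsRootSystem) {g : R.Aut} (hg : g ∈ R.weylGroup) :
    ∀ β ∈ R.Φ, g β ∈ R.Φ := by
  refine Subgroup.closure_induction'' (p := fun g _ => ∀ β ∈ R.Φ, g β ∈ R.Φ) ?_ ?_ ?_ ?_ hg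
  · rintro _ ⟨j, rfl⟩ β hβ
    exact hR.s_mem (hR.simple_mem j) hβ
  · rintro _ ⟨j, rfl⟩ β hβ
    rw [hR.S_inv]
    exact hR.s_mem (hR.simple_mem j) hβ
  · intro β hβ
    exact hβ
  · intro a b _ _ ha hb β hβ
    exact ha _ (hb _ hβ)

/-- The coroot of `β` is the only functional whose reflection along `β` preserves the roots. -/
lemma coroot_unique (hR : R.IsRootSystem) {β : R.V} (hβ : β ∈ R.Φ) {f : Module.Dual ℚ R.V}
    (hf : f β = 2) (hmaps : ∀ γ ∈ R.Φ, γ - f γ • β ∈ R.Φ) : f = R.coroot β := by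
  refine Module.Dual.eq_of_preReflection_mapsTo hR.finite hR.span_top hf ?_
    (hR.coroot_self β hβ) ?_
  · intro γ hγ
    exact hmaps γ hγ
  · intro γ hγ
    exact hR.reflection_stable β hβ γ hγ

lemma coroot_weylGroup (hR : R.IsRootSystem) {g : R.Aut} (hg : g ∈ R.weylGroup) {β : R.V}
    (hβ : β ∈ R.Φ) (y : R.V) : R.coroot (g β) (g y) = R.coroot β y := by
  have hg' := R.weylGroup.inv_mem hg
  have key : (R.coroot β).comp (g.symm : R.V →ₗ[ℚ] R.V) = R.coroot (g β) := by
    refine hR.coroot_unique (hR.weylGroup_stable hg β hβ) (by simp [hR.coroot_self β hβ]) ?_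
    intro γ hγ
    have h1 := hR.weylGroup_stable hg _
      (hR.reflection_stable β hβ _ (hR.weylGroup_stable hg' γ hγ))
    have h2 : g (g⁻¹ γ) = γ := g.apply_symm_apply γ
    rw [map_sub, map_smul, h2] at h1
    exact h1
  rw [← key]
  simp

lemma s_weylGroup (hR : R.IsRootSystem) {g : R.Aut} (hg : g ∈ R.weylGroup) {β : R.V}
    (hβ : β ∈ R.Φ) : R.s (g β) * g = g * R.s β := by
  ext y
  simp only [LinearEquiv.mul_apply, hR.s_apply hβ, hR.s_apply (hR.weylGroup_stable hg β hβ),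
    hR.coroot_weylGroup hg hβ, map_sub, map_smul]

lemma coroot_neg (hR : R.IsRootSystem) {β : R.V} (hβ : β ∈ R.Φ) :
    R.coroot (-β) = -R.coroot β := by
  refine (hR.coroot_unique (hR.neg_mem hβ) ?_ ?_).symm
  · simp [hR.coroot_self β hβ]
  · intro γ hγ
    simpa using hR.reflection_stable β hβ γ hγ

/-- The only positive roots made negative by a simple reflection are the multiples of the
simple root. -/
lemma s_eq_S_of_notMem_pos (hR : R.IsRootSystem) {β : R.V} (hβ : β ∈ R.pos) {j : Fin R.r}
    (h : R.S j β ∉ R.pos) : R.s β = R.S j := by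
  have hΦ := hR.pos_subset hβ
  have hα := hR.simple_mem j
  obtain ⟨c, hc, hcβ⟩ := hR.pos_nonneg_comb β hβ
  obtain ⟨d, hd, hdβ⟩ := hR.pos_nonneg_comb _
    (hR.neg_mem_pos (hR.weylGroup_stable (S_mem_weylGroup j) β hΦ) h)
  set k : ℚ := R.coroot (R.α j) β
  have hsum : ∑ m, (c m + d m - if m = j then k else 0) • R.α m = 0 := by
    simp only [sub_smul, add_smul, Finset.sum_sub_distrib, Finset.sum_add_distrib, ite_smul,
      zero_smul, Finset.sum_ite_eq', Finset.mem_univ, if_true]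
    rw [← hcβ, ← hdβ, S, hR.s_apply hα]
    module
  have hcoef := Fintype.linearIndependent_iff.mp hR.indep _ hsum
  have hzero : ∀ m, m ≠ j → c m = 0 := by
    intro m hm
    have h1 := hcoef m
    rw [if_neg hm] at h1
    linarith [hc m, hd m]
  have hβj : β = c j • R.α j := by
    rw [hcβ, Finset.sum_eq_single j]
    · intro m _ hm
      rw [hzero m hm, zero_smul]
    · simp
  have hcj : c j ≠ 0 := by
    intro h0
    exact hR.ne_zero β hΦ (by rw [hβj, h0, zero_smul])
  have hco : (c j)⁻¹ • R.coroot (R.α j) = R.coroot β := by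
    refine hR.coroot_unique hΦ ?_ ?_
    · rw [hβj]
      simp [hR.coroot_self _ hα, hcj]
    · intro γ hγ
      have h1 := hR.reflection_stable _ hα γ hγ
      convert h1 using 2
      rw [hβj, smul_smul, LinearMap.smul_apply, smul_eq_mul]
      congr 1
      field_simp
  ext y
  rw [S, hR.s_apply hΦ, hR.s_apply hα, ← hco, LinearMap.smul_apply, smul_eq_mul]
  nth_rw 1 [hβj]
  rw [smul_smul]
  congr 2
  field_simp

end IsRootSystem

lemma wordProd_cons (j : Fin R.r) (l : List (Fin R.r)) :
    R.wordProd (j :: l) = R.S j * R.wordProd l := by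
  simp [wordProd]

lemma wordProd_append (l l' : List (Fin R.r)) :
    R.wordProd (l ++ l') = R.wordProd l * R.wordProd l' := by
  simp [wordProd]

lemma wordProd_mem (l : List (Fin R.r)) : R.wordProd l ∈ R.weylGroup := by
  refine Subgroup.list_prod_mem _ ?_
  intro g hg
  obtain ⟨j, _, rfl⟩ := List.mem_map.mp hg
  exact IsRootSystem.S_mem_weylGroup j

lemma len_wordProd_le (l : List (Fin R.r)) : R.len (R.wordProd l) ≤ l.length :=
  Nat.sInf_le ⟨l, rfl, rfl⟩

lemma len_lt_of_reduced_cons {j : Fin R.r} {l : List (Fin R.r)} (h : R.Reduced (j :: l)) :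
    R.len (R.wordProd l) < R.len (R.S j * R.wordProd l) := by
  have h1 : R.len (R.wordProd (j :: l)) = l.length + 1 := h
  rw [wordProd_cons] at h1
  have h2 := len_wordProd_le l
  omega

namespace IsRootSystem

lemma exists_wordProd (hR : R.IsRootSystem) {g : R.Aut} (hg : g ∈ R.weylGroup) :
    ∃ l, R.wordProd l = g := by
  refine Subgroup.closure_induction'' (p := fun g _ => ∃ l, R.wordProd l = g) ?_ ?_ ?_ ?_ hg
  · rintro _ ⟨j, rfl⟩
    exact ⟨[j], by simp [wordProd]⟩
  · rintro _ ⟨j, rfl⟩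
    exact ⟨[j], by simp [wordProd, hR.S_inv]⟩
  · exact ⟨[], rfl⟩
  · rintro _ _ _ _ ⟨l, rfl⟩ ⟨l', rfl⟩
    exact ⟨l ++ l', wordProd_append l l'⟩

lemma exists_reduced (hR : R.IsRootSystem) {g : R.Aut} (hg : g ∈ R.weylGroup) :
    ∃ l, R.Reduced l ∧ R.wordProd l = g := by
  obtain ⟨l₀, h₀⟩ := hR.exists_wordProd hg
  obtain ⟨l, hl, hlg⟩ := Nat.sInf_mem
    (s := {n | ∃ l : List (Fin R.r), l.length = n ∧ R.wordProd l = g}) ⟨_, l₀, rfl, h₀⟩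
  refine ⟨l, ?_, hlg⟩
  rw [Reduced, hlg, hl, len]

lemma reduced_of_cons (hR : R.IsRootSystem) {j : Fin R.r} {l : List (Fin R.r)}
    (h : R.Reduced (j :: l)) : R.Reduced l := by
  obtain ⟨l', hl', heq⟩ := hR.exists_reduced (wordProd_mem l)
  have h1 : R.len (R.wordProd (j :: l)) = l.length + 1 := h
  have h2 := len_wordProd_le (j :: l')
  rw [wordProd_cons, heq, ← wordProd_cons, h1, List.length_cons, ← hl', heq] at h2
  exact le_antisymm (len_wordProd_le l) (by omega)

/-- The strong exchange condition. -/
lemma exchange (hR : R.IsRootSystem) {β : R.V} (hβ : β ∈ R.pos) (l : List (Fin R.r))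
    (h : R.wordProd l β ∉ R.pos) :
    ∃ l' : List (Fin R.r), l'.length < l.length ∧ R.wordProd l * R.s β = R.wordProd l' := by
  induction l with
  | nil => exact absurd hβ h
  | cons j l ih =>
    by_cases hl : R.wordProd l β ∈ R.pos
    · refine ⟨l, by simp, ?_⟩
      have h1 : R.s (R.wordProd l β) = R.S j := by
        refine hR.s_eq_S_of_notMem_pos hl ?_
        rwa [wordProd_cons] at h
      rw [wordProd_cons, mul_assoc, ← hR.s_weylGroup (wordProd_mem l) (hR.pos_subset hβ), h1,
        ← mul_assoc, hR.S_mul_self, one_mul]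
    · obtain ⟨l', hlen, hl'⟩ := ih hl
      exact ⟨j :: l', by simpa using hlen, by rw [wordProd_cons, wordProd_cons, mul_assoc, hl']⟩

lemma len_mul_s_lt (hR : R.IsRootSystem) {g : R.Aut} (hg : g ∈ R.weylGroup) {β : R.V}
    (hβ : β ∈ R.pos) (h : g β ∉ R.pos) : R.len (g * R.s β) < R.len g := by
  obtain ⟨l, hl, rfl⟩ := hR.exists_reduced hg
  obtain ⟨l', hlen, hl'⟩ := hR.exchange hβ l h
  rw [hl', hl]
  exact (len_wordProd_le l').trans_lt hlen

lemma len_lt_mul_S (hR : R.IsRootSystem) {g : R.Aut} (hg : g ∈ R.weylGroup) {j : Fin R.r}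
    (h : g (R.α j) ∈ R.pos) : R.len g < R.len (g * R.S j) := by
  have h1 := hR.len_mul_s_lt (R.weylGroup.mul_mem hg (S_mem_weylGroup j)) (hR.simple_pos j) (by
    rw [LinearEquiv.mul_apply, hR.S_simple, map_neg]
    exact hR.neg_notMem_pos h)
  rwa [← S, mul_assoc, hR.S_mul_self, mul_one] at h1

lemma len_inv (hR : R.IsRootSystem) (g : R.Aut) : R.len g⁻¹ = R.len g := by
  have key : ∀ l : List (Fin R.r), R.wordProd l.reverse = (R.wordProd l)⁻¹ := by
    intro l
    induction l with
    | nil => simp [wordProd]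
    | cons j l ih =>
      rw [List.reverse_cons, wordProd_append, ih, wordProd_cons j l, mul_inv_rev, hR.S_inv]
      simp [wordProd]
  unfold len
  congr 1
  ext n
  constructor
  · rintro ⟨l, hl, h⟩
    exact ⟨l.reverse, by simpa using hl, by rw [key, h, inv_inv]⟩
  · rintro ⟨l, hl, h⟩
    exact ⟨l.reverse, by simpa using hl, by rw [key, h]⟩

/-- A nontrivial element of the Weyl group makes some simple root negative. -/
lemma exists_descent (hR : R.IsRootSystem) {g : R.Aut} (hg : g ∈ R.weylGroup) (h1 : g ≠ 1) :
    ∃ j, g (R.α j) ∉ R.pos := by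
  obtain ⟨l, hl, rfl⟩ := hR.exists_reduced hg
  rcases List.eq_nil_or_concat l with rfl | ⟨l, j, rfl⟩
  · exact absurd rfl h1
  · refine ⟨j, fun hpos => ?_⟩
    have h2 := hR.len_lt_mul_S hg hpos
    rw [List.concat_eq_append] at h2 hl
    have h3 : R.wordProd (l ++ [j]) * R.S j = R.wordProd l := by
      rw [wordProd_append]
      simp [wordProd, mul_assoc, hR.S_mul_self]
    rw [h3, hl] at h2
    have h4 := len_wordProd_le l
    simp at h2
    omega

/-- Induction on the Weyl group by removing right descents. -/
lemma descent_induction (hR : R.IsRootSystem) {p : R.Aut → Prop} (one : p 1)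
    (step : ∀ g ∈ R.weylGroup, ∀ j, g (R.α j) ∉ R.pos → p (g * R.S j) → p g)
    {g : R.Aut} (hg : g ∈ R.weylGroup) : p g := by
  induction hn : R.len g using Nat.strong_induction_on generalizing g with
  | _ n ih =>
    by_cases h1 : g = 1
    · rwa [h1]
    obtain ⟨j, hj⟩ := hR.exists_descent hg h1
    refine step g hg j hj (ih _ ?_ (R.weylGroup.mul_mem hg (S_mem_weylGroup j)) rfl)
    rw [← hn]
    exact hR.len_mul_s_lt hg (hR.simple_pos j) hj

/-- A dominant weight pairs nonnegatively with all positive coroots. -/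
lemma coroot_nonneg (hR : R.IsRootSystem) {lam : R.V} (hdom : R.Dominant lam) {β : R.V}
    (hβ : β ∈ R.pos) : 0 ≤ R.coroot β lam := by
  let B : R.V → R.V → ℚ := fun y z => ∑ γ ∈ hR.finite.toFinset, R.coroot γ y * R.coroot γ z
  have hcor : ∀ {β : R.V}, β ∈ R.Φ → ∀ {γ : R.V}, γ ∈ R.Φ → ∀ y,
      R.coroot (R.s β γ) (R.s β y) = R.coroot γ y := by
    intro β hβ γ hγ y
    have hmem : ∀ δ ∈ R.Φ, R.s β δ ∈ R.Φ := fun _ => hR.s_mem hβ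
    have hinv : ∀ z, R.s β (R.s β z) = z := hR.s_s_apply hβ
    have key : (R.coroot γ).comp (R.s β : R.V →ₗ[ℚ] R.V) = R.coroot (R.s β γ) := by
      refine hR.coroot_unique (hmem γ hγ) (by simp [hinv, hR.coroot_self γ hγ]) ?_
      intro δ hδ
      have h1 := hmem _ (hR.reflection_stable γ hγ _ (hmem δ hδ))
      rw [map_sub, map_smul, hinv] at h1
      exact h1
    rw [← key]
    simp [hinv]
  have hB : ∀ {β : R.V}, β ∈ R.Φ → ∀ y, 2 * B β y = R.coroot β y * B β β := by
    intro β hβ y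
    have hmem : ∀ δ ∈ R.Φ, R.s β δ ∈ R.Φ := fun _ => hR.s_mem hβ
    have hinv : ∀ z, R.s β (R.s β z) = z := hR.s_s_apply hβ
    have h1 : B (R.s β β) (R.s β y) = B β y := by
      refine (Finset.sum_nbij' (R.s β) (R.s β) ?_ ?_ ?_ ?_ ?_).symm
      · simpa using hmem
      · simpa using hmem
      · intro z _
        exact hinv z
      · intro z _
        exact hinv z
      · intro γ hγ
        rw [hcor hβ (by simpa using hγ), hcor hβ (by simpa using hγ)]
    have h2 : B (R.s β β) (R.s β y) = - B β y + R.coroot β y * B β β := by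
      simp only [B, hR.s_self hβ, hR.s_apply hβ y, map_neg, map_sub, map_smul, smul_eq_mul,
        Finset.mul_sum, ← Finset.sum_neg_distrib, ← Finset.sum_add_distrib]
      refine Finset.sum_congr rfl fun γ _ => ?_
      ring
    linarith
  have hBpos : ∀ {β : R.V}, β ∈ R.Φ → 0 < B β β := by
    intro β hβ
    refine Finset.sum_pos' (fun γ _ => mul_self_nonneg _) ⟨β, by simpa using hβ, ?_⟩
    rw [hR.coroot_self β hβ]
    norm_num
  have hαB : ∀ j, 0 ≤ B (R.α j) lam := by
    intro j
    have h1 := hB (hR.simple_mem j) lam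
    have h2 := mul_nonneg (hdom j) (hBpos (hR.simple_mem j)).le
    linarith
  obtain ⟨c, hc, hcβ⟩ := hR.pos_nonneg_comb β hβ
  have hβB : B β lam = ∑ j, c j * B (R.α j) lam := by
    simp only [B, Finset.mul_sum]
    rw [Finset.sum_comm]
    refine Finset.sum_congr rfl fun γ _ => ?_
    conv_lhs => rw [hcβ]
    simp only [map_sum, map_smul, smul_eq_mul, Finset.sum_mul, mul_assoc]
  have h1 := hB (hR.pos_subset hβ) lam
  have h2 : 0 ≤ B β lam := by
    rw [hβB]
    exact Finset.sum_nonneg fun j _ => mul_nonneg (hc j) (hαB j)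
  by_contra! hneg
  have h3 := mul_neg_of_neg_of_pos hneg (hBpos (hR.pos_subset hβ))
  linarith

lemma coweight_nonneg (hR : R.IsRootSystem) {x : Fin R.r → Module.Dual ℚ R.V}
    (hx : ∀ i j : Fin R.r, x j (R.α i) = if i = j then 1 else 0) (i : Fin R.r) {β : R.V}
    (hβ : β ∈ R.pos) : 0 ≤ x i β := by
  obtain ⟨c, hc, rfl⟩ := hR.pos_nonneg_comb β hβ
  simpa [hx] using hc i

/-- The stabilizer of the fundamental coweight `x i` is contained in `W_{P_i}`. -/
lemma mem_WPar_of_coweight_fixed (hR : R.IsRootSystem) {x : Fin R.r → Module.Dual ℚ R.V}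
    (hx : ∀ i j : Fin R.r, x j (R.α i) = if i = j then 1 else 0) (i : Fin R.r) {g : R.Aut}
    (hg : g ∈ R.weylGroup) (hfix : ∀ y, x i (g y) = x i y) : g ∈ R.WPar i := by
  revert hfix
  refine hR.descent_induction (p := fun g => (∀ y, x i (g y) = x i y) → g ∈ R.WPar i) ?_ ?_ hg
  · intro _
    exact one_mem _
  · intro g hg j hj ih hfix
    have h1 := hR.coweight_nonneg hx i (hR.simple_pos j)
    have h2 := hR.coweight_nonneg hx i
      (hR.neg_mem_pos (hR.weylGroup_stable hg _ (hR.simple_mem j)) hj)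
    rw [map_neg, hfix] at h2
    have h3 : x i (R.α j) = 0 := by linarith
    have hji : j ≠ i := by
      rintro rfl
      simp [hx] at h3
    have h4 : g * R.S j ∈ R.WPar i := by
      refine ih fun y => ?_
      rw [LinearEquiv.mul_apply, hfix, S, hR.s_apply (hR.simple_mem j), map_sub, map_smul, h3]
      simp
    have h5 : R.S j ∈ R.WPar i := Subgroup.subset_closure ⟨j, hji, rfl⟩
    rwa [Subgroup.mul_mem_cancel_right _ h5] at h4

lemma coweight_fixed_of_mem_WPar (hR : R.IsRootSystem) {x : Fin R.r → Module.Dual ℚ R.V}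
    (hx : ∀ i j : Fin R.r, x j (R.α i) = if i = j then 1 else 0) (i : Fin R.r) {g : R.Aut}
    (hg : g ∈ R.WPar i) : ∀ y, x i (g y) = x i y := by
  have hS : ∀ j, j ≠ i → ∀ y, x i (R.S j y) = x i y := by
    intro j hj y
    rw [S, hR.s_apply (hR.simple_mem j), map_sub, map_smul, hx, if_neg hj]
    simp
  refine Subgroup.closure_induction'' (p := fun g _ => ∀ y, x i (g y) = x i y) ?_ ?_ ?_ ?_ hg
  · rintro _ ⟨j, hj, rfl⟩
    exact hS j hj
  · rintro _ ⟨j, hj, rfl⟩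
    rw [hR.S_inv]
    exact hS j hj
  · intro y
    rfl
  · intro a b _ _ ha hb y
    rw [LinearEquiv.mul_apply, ha, hb]

lemma WPar_le (i : Fin R.r) : R.WPar i ≤ R.weylGroup := by
  refine Subgroup.closure_mono ?_
  rintro _ ⟨j, _, rfl⟩
  exact ⟨j, rfl⟩

end IsRootSystem

/-- `y` is obtained from `x` by a length-increasing left multiplication by a reflection of
the Weyl group. -/
def BruhatStep (R : RootData) (x y : R.Aut) : Prop :=
  ∃ β ∈ R.pos, R.s β ∈ R.weylGroup ∧ x⁻¹ β ∈ R.pos ∧ y = R.s β * x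

/-- The Bruhat order described by chains of reflections. -/
def ChainLE (R : RootData) : R.Aut → R.Aut → Prop := Relation.ReflTransGen R.BruhatStep

lemma ChainLE.refl (x : R.Aut) : R.ChainLE x x := Relation.ReflTransGen.refl

lemma ChainLE.trans {x y z : R.Aut} (h : R.ChainLE x y) (h' : R.ChainLE y z) : R.ChainLE x z :=
  Relation.ReflTransGen.trans h h'

lemma BruhatStep.chainLE {x y : R.Aut} (h : R.BruhatStep x y) : R.ChainLE x y :=
  Relation.ReflTransGen.single h

namespace IsRootSystem

lemma bruhatStep_S_mul (hR : R.IsRootSystem) {x y : R.Aut} (h : R.BruhatStep x y)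
    (j : Fin R.r) : R.S j * x = y ∨ R.BruhatStep (R.S j * x) (R.S j * y) := by
  obtain ⟨β, hβ, hW, hx, rfl⟩ := h
  by_cases hj : R.S j β ∈ R.pos
  · right
    have hconj := hR.s_weylGroup (S_mem_weylGroup j) (hR.pos_subset hβ)
    refine ⟨R.S j β, hj, ?_, ?_, ?_⟩
    · rw [eq_mul_inv_of_mul_eq hconj]
      exact mul_mem (mul_mem (S_mem_weylGroup j) hW) (inv_mem (S_mem_weylGroup j))
    · have h1 : (R.S j * x)⁻¹ (R.S j β) = x⁻¹ β := by
        rw [← LinearEquiv.mul_apply]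
        congr 1
        group
      rwa [h1]
    · rw [← mul_assoc, ← mul_assoc, hconj]
  · left
    rw [hR.s_eq_S_of_notMem_pos hβ hj]

lemma S_mul_S_mul (hR : R.IsRootSystem) (j : Fin R.r) (x : R.Aut) :
    R.S j * (R.S j * x) = x := by
  rw [← mul_assoc, hR.S_mul_self, one_mul]

lemma chainLE_S_mul (hR : R.IsRootSystem) {x y : R.Aut} (h : R.ChainLE x y) (j : Fin R.r) :
    R.ChainLE (R.S j * x) y ∨ R.ChainLE (R.S j * x) (R.S j * y) := by
  induction h using Relation.ReflTransGen.head_induction_on with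
  | refl => exact Or.inr (ChainLE.refl _)
  | head hstep hchain ih =>
    rcases hR.bruhatStep_S_mul hstep j with h | h
    · left
      rw [h]
      exact hchain
    · exact ih.imp h.chainLE.trans h.chainLE.trans

lemma chainLE_S_mul_right (hR : R.IsRootSystem) {x y : R.Aut} (h : R.ChainLE x y)
    (j : Fin R.r) : R.ChainLE x (R.S j * y) ∨ R.ChainLE (R.S j * x) (R.S j * y) := by
  induction h using Relation.ReflTransGen.head_induction_on with
  | refl => exact Or.inr (ChainLE.refl _)
  | @head a b hstep hchain ih =>
    rcases ih with ih | ih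
    · exact Or.inl (hstep.chainLE.trans ih)
    · rcases hR.bruhatStep_S_mul hstep j with h | h
      · left
        rwa [← h, hR.S_mul_S_mul] at ih
      · exact Or.inr (h.chainLE.trans ih)

lemma bruhatStep_S_mul_of_pos {x : R.Aut} (hR : R.IsRootSystem) {j : Fin R.r}
    (h : x⁻¹ (R.α j) ∈ R.pos) : R.BruhatStep x (R.S j * x) :=
  ⟨R.α j, hR.simple_pos j, S_mem_weylGroup j, h, rfl⟩

lemma bruhatStep_of_notMem_pos {x : R.Aut} (hR : R.IsRootSystem) (hx : x ∈ R.weylGroup)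
    {j : Fin R.r} (h : x⁻¹ (R.α j) ∉ R.pos) : R.BruhatStep (R.S j * x) x := by
  have h1 : R.BruhatStep (R.S j * x) (R.S j * (R.S j * x)) := by
    refine hR.bruhatStep_S_mul_of_pos ?_
    rw [mul_inv_rev, hR.S_inv, LinearEquiv.mul_apply, hR.S_simple, map_neg]
    exact hR.neg_mem_pos (hR.weylGroup_stable (inv_mem hx) _ (hR.simple_mem j)) h
  rwa [hR.S_mul_S_mul] at h1

lemma len_S_mul (hR : R.IsRootSystem) (x : R.Aut) (j : Fin R.r) :
    R.len (R.S j * x) = R.len (x⁻¹ * R.S j) := by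
  rw [← hR.len_inv, mul_inv_rev, hR.S_inv]

lemma bruhatStep_of_len_lt (hR : R.IsRootSystem) {x : R.Aut} (hx : x ∈ R.weylGroup)
    {j : Fin R.r} (h : R.len x < R.len (R.S j * x)) : R.BruhatStep x (R.S j * x) := by
  refine hR.bruhatStep_S_mul_of_pos ?_
  by_contra hneg
  have h1 := hR.len_mul_s_lt (inv_mem hx) (hR.simple_pos j) hneg
  rw [← S, ← hR.len_S_mul, hR.len_inv] at h1
  omega

lemma bruhatStep_of_not_len_lt (hR : R.IsRootSystem) {x : R.Aut} (hx : x ∈ R.weylGroup)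
    {j : Fin R.r} (h : ¬ R.len x < R.len (R.S j * x)) : R.BruhatStep (R.S j * x) x := by
  refine hR.bruhatStep_of_notMem_pos hx fun hpos => h ?_
  have h1 := hR.len_lt_mul_S (inv_mem hx) hpos
  rwa [← hR.len_S_mul, hR.len_inv] at h1

lemma dmulStep_mem {x : R.Aut} (hx : x ∈ R.weylGroup) (j : Fin R.r) :
    R.dmulStep j x ∈ R.weylGroup := by
  unfold dmulStep
  split_ifs
  · exact mul_mem (S_mem_weylGroup j) hx
  · exact hx

lemma dmulList_mem {x : R.Aut} (hx : x ∈ R.weylGroup) (l : List (Fin R.r)) :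
    R.dmulList l x ∈ R.weylGroup := by
  induction l with
  | nil => exact hx
  | cons j l ih => exact dmulStep_mem ih j

lemma chainLE_dmulStep (hR : R.IsRootSystem) {x : R.Aut} (hx : x ∈ R.weylGroup)
    (j : Fin R.r) : R.ChainLE x (R.dmulStep j x) ∧ R.ChainLE (R.S j * x) (R.dmulStep j x) := by
  unfold dmulStep
  split_ifs with h
  · exact ⟨(hR.bruhatStep_of_len_lt hx h).chainLE, ChainLE.refl _⟩
  · exact ⟨ChainLE.refl _, (hR.bruhatStep_of_not_len_lt hx h).chainLE⟩

lemma eq_one_of_chainLE_one (hR : R.IsRootSystem) {x : R.Aut} (h : R.ChainLE x 1) : x = 1 := by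
  rcases Relation.ReflTransGen.cases_tail h with h | ⟨y, _, β, hβ, _, hy, h1⟩
  · exact h.symm
  · exfalso
    rw [← eq_inv_of_mul_eq_one_left h1.symm, hR.s_self (hR.pos_subset hβ)] at hy
    exact hR.neg_notMem_pos hβ hy

lemma chainLE_wordProd_cons (hR : R.IsRootSystem) {x : R.Aut} {j : Fin R.r}
    {l : List (Fin R.r)} (h : R.ChainLE x (R.wordProd (j :: l))) :
    R.ChainLE x (R.wordProd l) ∨ R.ChainLE (R.S j * x) (R.wordProd l) := by
  have h1 := hR.chainLE_S_mul_right h j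
  rwa [wordProd_cons, hR.S_mul_S_mul] at h1

lemma chainLE_dmulList (hR : R.IsRootSystem) {v : R.Aut} (hv : v ∈ R.weylGroup)
    (l : List (Fin R.r)) {x : R.Aut} (h : R.ChainLE x (R.wordProd l)) :
    R.ChainLE (x * v) (R.dmulList l v) := by
  induction l generalizing x with
  | nil =>
    rw [hR.eq_one_of_chainLE_one h, one_mul]
    exact ChainLE.refl _
  | cons j l ih =>
    have hd := hR.chainLE_dmulStep (dmulList_mem hv l) j
    change R.ChainLE (x * v) (R.dmulStep j (R.dmulList l v))
    rcases hR.chainLE_wordProd_cons h with h | h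
    · exact (ih h).trans hd.1
    · have h1 := hR.chainLE_S_mul (ih h) j
      rw [mul_assoc, hR.S_mul_S_mul] at h1
      rcases h1 with h1 | h1
      · exact h1.trans hd.1
      · exact h1.trans hd.2

lemma exists_sublist_of_chainLE (hR : R.IsRootSystem) (l : List (Fin R.r)) {x : R.Aut}
    (h : R.ChainLE x (R.wordProd l)) : ∃ l' : List (Fin R.r), l'.Sublist l ∧ R.wordProd l' = x := by
  induction l generalizing x with
  | nil => exact ⟨[], List.Sublist.refl _, (hR.eq_one_of_chainLE_one h).symm⟩
  | cons j l ih =>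
    rcases hR.chainLE_wordProd_cons h with h | h
    · obtain ⟨l', hl', rfl⟩ := ih h
      exact ⟨l', hl'.cons j, rfl⟩
    · obtain ⟨l', hl', hx⟩ := ih h
      exact ⟨j :: l', hl'.cons_cons j, by rw [wordProd_cons, hx, hR.S_mul_S_mul]⟩

lemma chainLE_of_sublist (hR : R.IsRootSystem) {l l' : List (Fin R.r)} (hl : R.Reduced l)
    (h : l'.Sublist l) : R.ChainLE (R.wordProd l') (R.wordProd l) := by
  induction h with
  | slnil => exact ChainLE.refl _
  | @cons l₁ l₂ j _ ih =>
    have h1 := hR.bruhatStep_of_len_lt (wordProd_mem l₂) (len_lt_of_reduced_cons hl)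
    rw [wordProd_cons]
    exact (ih (hR.reduced_of_cons hl)).trans h1.chainLE
  | @cons_cons l₁ l₂ j _ ih =>
    have h1 := hR.bruhatStep_of_len_lt (wordProd_mem l₂) (len_lt_of_reduced_cons hl)
    rw [wordProd_cons, wordProd_cons]
    exact (hR.chainLE_S_mul (ih (hR.reduced_of_cons hl)) j).elim (fun h => h.trans h1.chainLE) id

lemma bruhatLE_iff_chainLE (hR : R.IsRootSystem) {g w : R.Aut} (hw : w ∈ R.weylGroup) :
    R.BruhatLE g w ↔ R.ChainLE g w := by
  constructor
  · rintro ⟨l, hl, rfl, l', hsub, rfl⟩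
    exact hR.chainLE_of_sublist hl hsub
  · intro h
    obtain ⟨l, hl, rfl⟩ := hR.exists_reduced hw
    exact ⟨l, hl, rfl, hR.exists_sublist_of_chainLE l h⟩

lemma chainLE_mem {x y : R.Aut} (hx : x ∈ R.weylGroup) (h : R.ChainLE x y) :
    y ∈ R.weylGroup := by
  induction h with
  | refl => exact hx
  | tail _ hstep ih =>
    obtain ⟨β, _, hW, _, rfl⟩ := hstep
    exact mul_mem hW ih

lemma chainLE_inv (hR : R.IsRootSystem) {x y : R.Aut} (hx : x ∈ R.weylGroup)
    (h : R.ChainLE x y) : R.ChainLE x⁻¹ y⁻¹ := by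
  induction h with
  | refl => exact ChainLE.refl _
  | @tail b c hchain hstep ih =>
    have hb := chainLE_mem hx hchain
    obtain ⟨β, hβ, hW, hpos, rfl⟩ := hstep
    have hΦ := hR.pos_subset hβ
    have hconj := hR.s_weylGroup (inv_mem hb) hΦ
    refine ih.trans (BruhatStep.chainLE ⟨b⁻¹ β, hpos, ?_, ?_, ?_⟩)
    · rw [eq_mul_inv_of_mul_eq hconj]
      exact mul_mem (mul_mem (inv_mem hb) hW) (inv_mem (inv_mem hb))
    · rw [← LinearEquiv.mul_apply, inv_inv, mul_inv_cancel]
      exact hβ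
    · rw [hconj, mul_inv_rev, hR.s_inv hΦ]

lemma S_fix (hR : R.IsRootSystem) {lam : R.V} {j : Fin R.r} (h : R.coroot (R.α j) lam = 0) :
    R.S j lam = lam := by
  rw [S, hR.s_apply (hR.simple_mem j), h, zero_smul, sub_zero]

/-- If `w` is longest in its coset modulo the stabilizer of a dominant weight, the lower
interval of `w` is stable under that stabilizer. -/
lemma chainLE_mul_stabilizer (hR : R.IsRootSystem) {lam : R.V} (hdom : R.Dominant lam)
    {w : R.Aut} (hw : w ∈ R.weylGroup)
    (hmax : ∀ σ : R.Aut, σ ∈ R.weylGroup → σ lam = lam → R.len (w * σ) ≤ R.len w)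
    {σ : R.Aut} (hσ : σ ∈ R.weylGroup) (hfix : σ lam = lam) {g : R.Aut} (hg : g ∈ R.weylGroup)
    (h : R.ChainLE g w) : R.ChainLE (g * σ) w := by
  revert hfix
  refine hR.descent_induction (p := fun σ => σ lam = lam → R.ChainLE (g * σ) w) ?_ ?_ hσ
  · intro _
    rwa [mul_one]
  · intro σ hσ j hj ih hfix
    have hΦ := hR.weylGroup_stable hσ _ (hR.simple_mem j)
    have h1 := hdom j
    have h2 := hR.coroot_nonneg hdom (hR.neg_mem_pos hΦ hj)
    have h3 := hR.coroot_weylGroup hσ (hR.simple_mem j) lam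
    rw [hfix] at h3
    rw [hR.coroot_neg hΦ, LinearMap.neg_apply, h3] at h2
    have hj0 := hR.S_fix (le_antisymm (by linarith) h1)
    have h4 : R.ChainLE (g * (σ * R.S j)) w := ih (by rw [LinearEquiv.mul_apply, hj0, hfix])
    have hgσ := mul_mem hg (mul_mem hσ (S_mem_weylGroup j))
    have h5 := hR.chainLE_inv hgσ h4
    have h6 : R.BruhatStep (R.S j * w⁻¹) w⁻¹ := by
      refine hR.bruhatStep_of_not_len_lt (inv_mem hw) ?_
      rw [hR.len_S_mul, hR.len_inv, inv_inv, not_lt]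
      exact hmax _ (S_mem_weylGroup j) hj0
    have h7 : R.ChainLE (R.S j * (g * (σ * R.S j))⁻¹) w⁻¹ :=
      (hR.chainLE_S_mul h5 j).elim id (fun h => h.trans h6.chainLE)
    have h8 := hR.chainLE_inv (mul_mem (S_mem_weylGroup j) (inv_mem hgσ)) h7
    have h9 : (R.S j * (g * (σ * R.S j))⁻¹)⁻¹ = g * σ := by
      rw [mul_inv_rev, inv_inv, hR.S_inv, mul_assoc, mul_assoc, hR.S_mul_self, mul_one]
    rwa [h9, inv_inv] at h8

/-- The pairing of a dominant weight with a translated fundamental coweight decreases along the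
Bruhat order, and is constant only along stabilizer translates of cosets. -/
lemma exists_stabilizer_of_chainLE (hR : R.IsRootSystem) {x : Fin R.r → Module.Dual ℚ R.V}
    (hx : ∀ i j : Fin R.r, x j (R.α i) = if i = j then 1 else 0) {lam : R.V}
    (hdom : R.Dominant lam) (i : Fin R.r) {h k : R.Aut} (hh : h ∈ R.weylGroup)
    (hle : R.ChainLE h k) :
    x i (k⁻¹ lam) ≤ x i (h⁻¹ lam) ∧ (x i (h⁻¹ lam) = x i (k⁻¹ lam) →
      ∃ σ ∈ R.weylGroup, σ lam = lam ∧ k⁻¹ * (σ * h) ∈ R.WPar i) := by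
  revert hh
  induction hle using Relation.ReflTransGen.head_induction_on with
  | refl => exact fun _ => ⟨le_rfl, fun _ => ⟨1, one_mem _, rfl, by simp [one_mem]⟩⟩
  | @head a b hstep hchain ih =>
    intro ha
    obtain ⟨β, hβ, hW, hpos, rfl⟩ := hstep
    have hΦ := hR.pos_subset hβ
    obtain ⟨ih1, ih2⟩ := ih (mul_mem hW ha)
    have hval : x i ((R.s β * a)⁻¹ lam) = x i (a⁻¹ lam) - R.coroot β lam * x i (a⁻¹ β) := by
      rw [mul_inv_rev, hR.s_inv hΦ, LinearEquiv.mul_apply, hR.s_apply hΦ, map_sub, map_smul,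
        map_sub, map_smul, smul_eq_mul]
    have hprod := mul_nonneg (hR.coroot_nonneg hdom hβ) (hR.coweight_nonneg hx i hpos)
    refine ⟨by linarith, fun heq => ?_⟩
    have hzero : R.coroot β lam * x i (a⁻¹ β) = 0 := by linarith
    obtain ⟨σ, hσ, hfix, hmem⟩ := ih2 (by linarith)
    rcases mul_eq_zero.mp hzero with h0 | h0
    · refine ⟨σ * R.s β, mul_mem hσ hW, ?_, by rwa [mul_assoc]⟩
      rw [LinearEquiv.mul_apply, hR.s_apply hΦ, h0, zero_smul, sub_zero, hfix]
    · refine ⟨σ, hσ, hfix, ?_⟩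
      have hconj := hR.s_weylGroup (inv_mem ha) hΦ
      have hs : R.s (a⁻¹ β) ∈ R.WPar i := by
        refine hR.mem_WPar_of_coweight_fixed hx i ?_ fun y => ?_
        · rw [eq_mul_inv_of_mul_eq hconj]
          exact mul_mem (mul_mem (inv_mem ha) hW) (inv_mem (inv_mem ha))
        · rw [hR.s_apply (hR.pos_subset hpos), map_sub, map_smul, h0, smul_zero, sub_zero]
      have h1 : k⁻¹ * (σ * (R.s β * a)) = k⁻¹ * (σ * a) * R.s (a⁻¹ β) := by
        rw [eq_mul_inv_of_mul_eq hconj]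
        group
      rwa [h1, Subgroup.mul_mem_cancel_right _ hs] at hmem

end IsRootSystem

end RootData

theorem statement13 (R : RootData) (hR : R.IsRootSystem)
    (x : Fin R.r → Module.Dual ℚ R.V)
    (hx : ∀ i j : Fin R.r, x j (R.α i) = if i = j then 1 else 0)
    (lam : R.V) (hdom : R.Dominant lam)
    (w : R.Aut) (hw : w ∈ R.weylGroup)
    (hmax : ∀ σ : R.Aut, σ ∈ R.weylGroup → σ lam = lam → R.len (w * σ) ≤ R.len w)
    (i : Fin R.r) (v : R.Aut) (hv : v ∈ R.minReps i)
    (u : R.Aut) (hu : R.IsMinRep i u (R.dmul w⁻¹ v)) :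
    {m : R.V | ∃ g : R.Aut, g ∈ R.weylGroup ∧ R.BruhatLE g w ∧
        R.dualAct v (x i) (g lam) = R.dualAct u (x i) lam ∧ m = g lam} =
      {m : R.V | ∃ g : R.Aut, (∃ p ∈ R.WPar i, g = v * p * u⁻¹) ∧
        R.BruhatLE g w ∧ m = g lam} := by
  have hvW := hv.1
  obtain ⟨⟨huW, -⟩, hud⟩ := hu
  ext m
  constructor
  · rintro ⟨g, hg, hle, heq, rfl⟩
    have hgw := (hR.bruhatLE_iff_chainLE hw).mp hle
    have hex := hR.exists_reduced (inv_mem hw)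
    have hchain : R.ChainLE (g⁻¹ * v) (R.dmul w⁻¹ v) := by
      rw [RootData.dmul, dif_pos hex]
      refine hR.chainLE_dmulList hvW _ ?_
      rw [hex.choose_spec.2]
      exact hR.chainLE_inv hg hgw
    set d := R.dmul w⁻¹ v
    have hdval : x i (d⁻¹ lam) = x i (u⁻¹ lam) := by
      rw [← hR.coweight_fixed_of_mem_WPar hx i hud, ← LinearEquiv.mul_apply, mul_inv_cancel_right]
    have hval : x i ((g⁻¹ * v)⁻¹ lam) = x i (d⁻¹ lam) := by
      rw [hdval, mul_inv_rev, inv_inv]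
      exact heq
    obtain ⟨σ, hσ, hfix, hmem⟩ := (hR.exists_stabilizer_of_chainLE hx hdom i
      (mul_mem (inv_mem hg) hvW) hchain).2 hval
    have hfix' : σ⁻¹ lam = lam := by
      conv_lhs => rw [← hfix]
      exact σ.symm_apply_apply lam
    refine ⟨g * σ⁻¹, ⟨((u⁻¹ * d) * (d⁻¹ * (σ * (g⁻¹ * v))))⁻¹, inv_mem (mul_mem hud hmem), ?_⟩,
      ?_, ?_⟩
    · group
    · exact (hR.bruhatLE_iff_chainLE hw).mpr
        (hR.chainLE_mul_stabilizer hdom hw hmax (inv_mem hσ) hfix' hg hgw)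
    · rw [LinearEquiv.mul_apply, hfix']
  · rintro ⟨g, ⟨p, hp, rfl⟩, hle, rfl⟩
    refine ⟨_, mul_mem (mul_mem hvW (RootData.IsRootSystem.WPar_le i hp)) (inv_mem huW), hle,
      ?_, rfl⟩
    have h1 : v⁻¹ ((v * p * u⁻¹) lam) = p (u⁻¹ lam) := by
      rw [← LinearEquiv.mul_apply, ← LinearEquiv.mul_apply]
      congr 1
      group
    change x i (v⁻¹ ((v * p * u⁻¹) lam)) = x i (u⁻¹ lam)
    rw [h1, hR.coweight_fixed_of_mem_WPar hx i hp]
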